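/- Every C∞-word is uniquely determined by its vertical representation: if w and w' are C∞-words such that Ψ(w) = Ψ(w') and Ψ(w̃) = Ψ(w̃'), then w = w'. -/

import Mathlib

/- Common framework: words over the alphabet Σ = {1,2} (represented as natural
numbers), run-length encoding, the derivative D, k-differentiable words C^k,
C∞-words, heights, roots, primitives, minimal/maximal words, simple extensions,
minimal forbidden words, and the left frontier Ψ. -/

namespace CinftyWords

/-- A word is a finite sequence of natural numbers. -/
abbrev Word := List ℕ

/-- `w` is a word over the alphabet Σ = {1,2}. -/
def IsWord (w : Word) : Prop := ∀ x ∈ w, x = 1 ∨ x = 2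

/-- Complement of a letter: exchanges 1 and 2. -/
def bar (x : ℕ) : ℕ := 3 - x

/-- Letterwise complement of a word. -/
def comp (w : Word) : Word := w.map bar

/-- Run-length encoding Δ: the sequence of lengths of maximal runs of equal
consecutive letters. -/
def rle (w : Word) : Word := (w.splitBy (· == ·)).map List.length

/-- Drop the first run if it has length 1. -/
def dropFirstRun1 (g : List (List ℕ)) : List (List ℕ) :=
  match g with
  | [] => []
  | r :: rs => if r.length = 1 then rs else r :: rs

/-- The derivative `D w`: the run-length encoding of the word obtained from `w`
by deleting its first and/or last run when that run has length 1. -/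
def D (w : Word) : Word :=
  ((dropFirstRun1 ((dropFirstRun1 (w.splitBy (· == ·))).reverse)).reverse).map List.length

/-- `w` is differentiable: `w` is a word over Σ and so is its run-length encoding. -/
def Diffble (w : Word) : Prop := IsWord w ∧ IsWord (rle w)

/-- The set C^k of k-differentiable words: `D^[j] w` is differentiable for all `j < k`
(so that `D^[k] w` is defined). -/
def CK (k : ℕ) : Set Word := {w | IsWord w ∧ ∀ j < k, Diffble (D^[j] w)}

/-- The set C∞ of words differentiable arbitrarily many times. -/
def Cinf : Set Word := {w | ∀ k : ℕ, w ∈ CK k}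

/-- The height of a C∞-word: the least `k` with `D^[k] w = []`. -/
noncomputable def height (w : Word) : ℕ := sInf {k | D^[k] w = []}

/-- The root of a C∞-word: `D^[height w - 1] w`. -/
noncomputable def root (w : Word) : Word := D^[height w - 1] w

/-- `v` is a primitive of `w`: `v` is differentiable and `D v = w`. -/
def IsPrimitive (v w : Word) : Prop := Diffble v ∧ D v = w

/-- A nonempty C∞-word is maximal if each `D^[j] w` (for `j ≤ height w - 2`) is a
primitive of `D^[j+1] w` of maximal length (vacuously true when `height w = 1`). -/
def MaximalWord (w : Word) : Prop :=
  w ∈ Cinf ∧ w ≠ [] ∧ ∀ j, j + 2 ≤ height w →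
    ∀ v, IsPrimitive v (D^[j + 1] w) → v.length ≤ (D^[j] w).length

/-- A nonempty C∞-word is minimal if each `D^[j] w` (for `j ≤ height w - 2`) is a
primitive of `D^[j+1] w` of minimal length (vacuously true when `height w = 1`). -/
def MinimalWord (w : Word) : Prop :=
  w ∈ Cinf ∧ w ≠ [] ∧ ∀ j, j + 2 ≤ height w →
    ∀ v, IsPrimitive v (D^[j + 1] w) → (D^[j] w).length ≤ v.length

/-- `w` is right maximal: a suffix of a maximal word. -/
def RightMaximal (w : Word) : Prop := ∃ v, MaximalWord v ∧ w <:+ v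

/-- `w` is left maximal: a prefix of a maximal word. -/
def LeftMaximal (w : Word) : Prop := ∃ v, MaximalWord v ∧ w <+: v

/-- `w` is right minimal: a suffix of a minimal word. -/
def RightMinimal (w : Word) : Prop := ∃ v, MinimalWord v ∧ w <:+ v

/-- `w` is left minimal: a prefix of a minimal word. -/
def LeftMinimal (w : Word) : Prop := ∃ v, MinimalWord v ∧ w <+: v

/-- `w` is right doubly extendable: both `w1` and `w2` are C∞-words. -/
def RightDoublyExt (w : Word) : Prop := w ++ [1] ∈ Cinf ∧ w ++ [2] ∈ Cinf

/-- `w` is left doubly extendable: both `1w` and `2w` are C∞-words. -/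
def LeftDoublyExt (w : Word) : Prop := 1 :: w ∈ Cinf ∧ 2 :: w ∈ Cinf

/-- `w` is fully extendable: `1w1`, `1w2`, `2w1`, `2w2` are all C∞-words. -/
def FullyExt (w : Word) : Prop :=
  ∀ x, (x = 1 ∨ x = 2) → ∀ y, (y = 1 ∨ y = 2) → x :: (w ++ [y]) ∈ Cinf

/-- `w'` is a right simple extension of `w`: `w' = w ++ s` is a C∞-word and at each
step the extension by the complementary letter is not a C∞-word. -/
def RightSimpleExt (w w' : Word) : Prop :=
  w' ∈ Cinf ∧ ∃ s : Word, IsWord s ∧ w' = w ++ s ∧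
    ∀ i < s.length, w ++ s.take i ++ [bar (s.getD i 0)] ∉ Cinf

/-- `w'` is a left simple extension of `w`. -/
def LeftSimpleExt (w w' : Word) : Prop := RightSimpleExt w.reverse w'.reverse

/-- `w'` is a simple extension of `w`: a right simple extension of a left simple
extension of `w`. -/
def SimpleExt (w w' : Word) : Prop := ∃ v, LeftSimpleExt w v ∧ RightSimpleExt v w'

/-- `m` is the maximal extension of `w`: a simple extension of `w` of maximal length. -/
def IsMaximalExtension (w m : Word) : Prop :=
  SimpleExt w m ∧ ∀ v, SimpleExt w v → v.length ≤ m.length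

/-- A language is factorial if it is closed under taking factors. -/
def Factorial (F : Set Word) : Prop := ∀ v ∈ F, ∀ u, u <:+: v → u ∈ F

/-- A language is anti-factorial if no word of it is a proper factor of another
word of it. -/
def AntiFactorial (M : Set Word) : Prop := ∀ u ∈ M, ∀ v ∈ M, u ≠ v → ¬ u <:+: v

/-- The set of minimal forbidden words of a (factorial) language `F`: words not
in `F` whose maximal proper prefix and maximal proper suffix are both in `F`. -/
def MF (F : Set Word) : Set Word := {v | v ∉ F ∧ v.dropLast ∈ F ∧ v.tail ∈ F}

/-- The height of a minimal forbidden word of C∞: `k + 1`, where `k` is the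
(unique) integer such that `w` is k-differentiable and `D^[k] w ∈ {111, 222}`. -/
noncomputable def MFheight (w : Word) : ℕ :=
  sInf {k | w ∈ CK k ∧ (D^[k] w = [1, 1, 1] ∨ D^[k] w = [2, 2, 2])} + 1

/-- The left frontier Ψ of a C∞-word: the word of length `height w` over {0,1,2}
recording the first letter of each derivative, with `2` replaced by `0` when the
first two letters of the previous derivative are distinct. -/
noncomputable def psi (w : Word) : List ℕ :=
  (List.range (height w)).map (fun i =>
    if i = 0 then w.getD 0 0
    else if (D^[i] w).getD 0 0 = 2 ∧ (D^[i - 1] w).getD 0 0 ≠ (D^[i - 1] w).getD 1 0 then 0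
    else (D^[i] w).getD 0 0)

end CinftyWords

namespace CinftyWords

/-- Remove the first entry of a list if it equals 1. -/
def dropHeadOne : List ℕ → List ℕ
  | [] => []
  | a :: l => if a = 1 then l else a :: l

theorem map_length_dropFirstRun1 (g : List (List ℕ)) :
    (dropFirstRun1 g).map List.length = dropHeadOne (g.map List.length) := by
  cases g with
  | nil => rfl
  | cons r rs =>
    simp only [dropFirstRun1, dropHeadOne, List.map_cons]
    split <;> simp

theorem D_eq (u : Word) : D u = (dropHeadOne (dropHeadOne (rle u)).reverse).reverse := by
  simp [D, rle, map_length_dropFirstRun1, List.map_reverse]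

theorem dropHeadOne_comm (r : List ℕ) :
    (dropHeadOne (dropHeadOne r).reverse).reverse =
      dropHeadOne (dropHeadOne r.reverse).reverse := by
  rcases r with _ | ⟨a, t⟩
  · rfl
  · rcases List.eq_nil_or_concat t with rfl | ⟨t, b, rfl⟩
    · by_cases h : a = 1 <;> simp [dropHeadOne, h]
    · by_cases h : a = 1 <;> by_cases h' : b = 1 <;> simp [dropHeadOne, h, h']

theorem length_dropHeadOne_le (r : List ℕ) : (dropHeadOne r).length ≤ r.length := by
  cases r with
  | nil => rfl
  | cons a l => simp only [dropHeadOne]; split <;> simp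

theorem dropHeadOne_injective {r r' : List ℕ} (hn : dropHeadOne r ≠ [])
    (he : dropHeadOne r = dropHeadOne r') (hh : r.head? = some 1 ↔ r'.head? = some 1) :
    r = r' := by
  rcases r with _ | ⟨a, l⟩
  · simp [dropHeadOne] at hn
  · rcases r' with _ | ⟨b, l'⟩
    · exact absurd he hn
    · by_cases h : a = 1 <;> by_cases h' : b = 1 <;> grind [dropHeadOne]

theorem getLast?_dropHeadOne {r : List ℕ} (hn : dropHeadOne r ≠ []) :
    (dropHeadOne r).getLast? = r.getLast? := by
  rcases r with _ | ⟨a, l⟩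
  · rfl
  · by_cases h : a = 1
    · simp only [dropHeadOne, h, if_true] at hn ⊢
      cases l <;> simp_all
    · simp [dropHeadOne, h]

theorem head?_eq_one_of_dropHeadOne {r : List ℕ} (h : (dropHeadOne r).head? = some 1) :
    r.head? = some 1 := by
  rcases r with _ | ⟨a, l⟩
  · exact h
  · by_cases ha : a = 1
    · simp [ha]
    · simp [dropHeadOne, ha] at h

theorem rle_nil : rle [] = [] := by simp [rle]

theorem rle_replicate_append (k x : ℕ) {t : Word} (ht : t.head? ≠ some x) :
    rle (List.replicate (k + 1) x ++ t) = (k + 1) :: rle t := by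
  unfold rle
  rw [List.splitBy_append, List.splitBy_of_isChain (l := List.replicate (k + 1) x)]
  · simp
  · simp
  · simp [List.isChain_replicate_of_rel]
  · intro a ha y hy
    have : a = x := List.eq_of_mem_replicate (List.mem_of_mem_getLast? ha)
    subst this
    simp only [beq_eq_false_iff_ne]
    rintro rfl
    exact ht hy

theorem exists_eq_replicate_append {u : Word} (hu : u ≠ []) :
    ∃ k x t, u = List.replicate (k + 1) x ++ t ∧ t.head? ≠ some x := by
  induction u with
  | nil => exact absurd rfl hu
  | cons a l ih =>
    by_cases h : l.head? = some a
    · obtain ⟨k, x, t, rfl, ht⟩ := ih (by rintro rfl; exact absurd h (by simp))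
      obtain rfl : x = a := by simpa [List.replicate_succ] using h
      exact ⟨k + 1, x, t, by simp [List.replicate_succ], ht⟩
    · exact ⟨0, a, l, by simp, h⟩

theorem rle_reverse (u : Word) : rle u.reverse = (rle u).reverse := by
  have h := (List.splitBy_eq_iff (r := fun a b : ℕ => a == b)
    (m := u) (l := u.splitBy (· == ·))).1 rfl
  have : u.reverse.splitBy (· == ·) = ((u.splitBy (· == ·)).map List.reverse).reverse := by
    rw [List.splitBy_eq_iff]
    refine ⟨?_, ?_, ?_, ?_⟩
    · rw [← List.reverse_flatten, List.flatten_splitBy]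
    · simp
    · intro m hm
      simp only [List.mem_reverse, List.mem_map] at hm
      obtain ⟨n, hn, rfl⟩ := hm
      rw [List.isChain_reverse]
      refine (h.2.2.1 n hn).imp ?_
      intro a b hab
      rw [beq_iff_eq] at hab ⊢
      exact hab.symm
    · rw [List.isChain_reverse, List.isChain_map]
      refine h.2.2.2.imp ?_
      rintro a b ⟨ha, hb, hab⟩
      refine ⟨by simpa using hb, by simpa using ha, ?_⟩
      rw [beq_eq_false_iff_ne] at hab ⊢
      simpa using hab.symm
  simp [rle, this, List.map_reverse, Function.comp_def]

theorem D_reverse (u : Word) : D u.reverse = (D u).reverse := by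
  rw [D_eq, D_eq, dropHeadOne_comm, rle_reverse]
  simp

theorem iterate_D_reverse (i : ℕ) (u : Word) : D^[i] u.reverse = (D^[i] u).reverse :=
  ((show Function.Semiconj List.reverse D D from fun u => (D_reverse u).symm).iterate_right i u).symm

theorem height_reverse (u : Word) : height u.reverse = height u := by
  simp [height, iterate_D_reverse]

theorem length_rle_le (u : Word) : (rle u).length ≤ u.length := by
  induction hn : u.length using Nat.strong_induction_on generalizing u with
  | _ n ih =>
    by_cases hu : u = []
    · simp [hu, rle_nil]
    · obtain ⟨k, x, t, rfl, ht⟩ := exists_eq_replicate_append hu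
      simp only [List.length_append, List.length_replicate] at hn
      have := ih t.length (by omega) t rfl
      rw [rle_replicate_append _ _ ht, List.length_cons]
      omega

theorem length_D_lt {u : Word} (hu : u ≠ []) : (D u).length < u.length := by
  have h1 := length_dropHeadOne_le (dropHeadOne (rle u)).reverse
  rw [D_eq]
  simp only [List.length_reverse] at h1 ⊢
  refine h1.trans_lt ?_
  obtain ⟨k, x, t, rfl, ht⟩ := exists_eq_replicate_append hu
  have := length_rle_le t
  rw [rle_replicate_append _ _ ht, dropHeadOne]
  split <;> simp <;> omega

theorem exists_iterate_D_eq_nil (u : Word) : ∃ k, D^[k] u = [] := by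
  induction hn : u.length using Nat.strong_induction_on generalizing u with
  | _ n ih =>
    by_cases hu : u = []
    · exact ⟨0, hu⟩
    · obtain ⟨k, hk⟩ := ih _ (hn ▸ length_D_lt hu) (D u) rfl
      exact ⟨k + 1, hk⟩

theorem iterate_D_height (u : Word) : D^[height u] u = [] :=
  Nat.sInf_mem (s := {k | D^[k] u = []}) (exists_iterate_D_eq_nil u)

theorem iterate_D_ne_nil {u : Word} {i : ℕ} (h : i < height u) : D^[i] u ≠ [] :=
  Nat.notMem_of_lt_sInf (s := {k | D^[k] u = []}) h

theorem eq_of_rle_eq {u u' : Word} (hu : IsWord u) (hu' : IsWord u') (hr : rle u = rle u')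
    (hh : u.head? = u'.head?) : u = u' := by
  induction hn : u.length using Nat.strong_induction_on generalizing u u' with
  | _ n ih =>
    by_cases h : u = []
    · subst h
      simpa [eq_comm] using hh
    · have h' : u' ≠ [] := by rintro rfl; simp_all
      obtain ⟨k, x, t, rfl, ht⟩ := exists_eq_replicate_append h
      obtain ⟨k', x', t', rfl, ht'⟩ := exists_eq_replicate_append h'
      obtain rfl : x = x' := by simpa [List.replicate_succ] using hh
      rw [rle_replicate_append _ _ ht, rle_replicate_append _ _ ht'] at hr
      obtain ⟨hk, hr⟩ := List.cons.inj hr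
      have hx := hu x (by simp)
      have hw : IsWord t := fun y hy => hu y (by simp [hy])
      have hw' : IsWord t' := fun y hy => hu' y (by simp [hy])
      have hl : t.head? = t'.head? := by
        rcases t with _ | ⟨a, t⟩ <;> rcases t' with _ | ⟨b, t'⟩
        · rfl
        · simp [rle] at hr
        · simp [rle] at hr
        · have := hw a (by simp)
          have := hw' b (by simp)
          simp only [List.head?_cons, ne_eq, Option.some.injEq] at ht ht' ⊢
          omega
      simp only [List.length_append, List.length_replicate] at hn
      rw [hk, ih t.length (by omega) hw hw' hr hl rfl]

theorem head?_rle_eq_one_iff {u : Word} (hu : IsWord u) (hl : rle u ≠ [1]) :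
    (rle u).head? = some 1 ↔ u.getD 0 0 ≠ u.getD 1 0 := by
  by_cases h : u = []
  · simp [h, rle_nil]
  · obtain ⟨k, x, t, rfl, ht⟩ := exists_eq_replicate_append h
    rw [rle_replicate_append _ _ ht] at hl ⊢
    rcases k with _ | k
    · rcases t with _ | ⟨a, t⟩
      · simp [rle_nil] at hl
      · simpa [eq_comm] using ht
    · simp [List.replicate_succ]

/-- The letter that the left frontier of a word with a derivative equal to `u` records for
`D u`. -/
def frontierLetter (u : Word) : ℕ :=
  if (D u).getD 0 0 = 2 ∧ u.getD 0 0 ≠ u.getD 1 0 then 0 else (D u).getD 0 0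

theorem head?_rle_eq_one_iff_frontierLetter {u : Word} (hu : IsWord u) (hn : D u ≠ [])
    (hD : IsWord (D u)) : (rle u).head? = some 1 ↔ frontierLetter u ≠ 2 := by
  have hl : rle u ≠ [1] := by
    intro h
    simp [D_eq, h, dropHeadOne] at hn
  have h1 : (D u).getD 0 0 = 1 → (rle u).head? = some 1 := by
    intro h
    apply head?_eq_one_of_dropHeadOne
    have hne : dropHeadOne (dropHeadOne (rle u)).reverse ≠ [] := by
      simpa [D_eq] using hn
    have := getLast?_dropHeadOne hne
    rw [List.getLast?_reverse] at this
    rw [← this, ← List.head?_reverse, ← D_eq]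
    cases hd : D u <;> simp_all
  have h2 : (D u).getD 0 0 = 1 ∨ (D u).getD 0 0 = 2 := by
    cases hd : D u with
    | nil => exact absurd hd hn
    | cons a l => exact hD a (by simp [hd])
  have h3 := head?_rle_eq_one_iff hu hl
  unfold frontierLetter
  rcases h2 with h2 | h2
  · simp only [h2] at h1 ⊢
    simp [h1]
  · rw [h3, h2]
    by_cases h : u.getD 0 0 = u.getD 1 0 <;> simp

theorem rle_eq_of_D_eq_nil {u : Word} (hn : u ≠ []) (h : D u = []) :
    rle u = [1] ∨ rle u = [1, 1] := by
  have hr : rle u ≠ [] := by simpa [rle] using hn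
  rw [D_eq] at h
  generalize rle u = r at h hr
  rcases r with _ | ⟨a, t⟩
  · exact absurd rfl hr
  · rcases List.eq_nil_or_concat t with rfl | ⟨t, b, rfl⟩
    · by_cases ha : a = 1 <;> simp_all [dropHeadOne]
    · by_cases ha : a = 1 <;> by_cases hb : b = 1 <;> simp_all [dropHeadOne]

theorem head?_eq_getLast?_of_rle_eq {u : Word} (h : rle u = [1]) : u.head? = u.getLast? := by
  have hn : u ≠ [] := by rintro rfl; simp [rle] at h
  obtain ⟨k, x, t, rfl, ht⟩ := exists_eq_replicate_append hn
  rw [rle_replicate_append _ _ ht] at h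
  obtain ⟨hk, h⟩ := List.cons.inj h
  obtain rfl : k = 0 := by omega
  obtain rfl : t = [] := by simpa [rle] using h
  simp

theorem head?_ne_getLast?_of_rle_eq {u : Word} (h : rle u = [1, 1]) :
    u.head? ≠ u.getLast? := by
  have hn : u ≠ [] := by rintro rfl; simp [rle] at h
  obtain ⟨k, x, t, rfl, ht⟩ := exists_eq_replicate_append hn
  rw [rle_replicate_append _ _ ht] at h
  obtain ⟨hk, h'⟩ := List.cons.inj h
  obtain rfl : k = 0 := by omega
  have hT : t ≠ [] := by rintro rfl; simp [rle] at h'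
  have := head?_eq_getLast?_of_rle_eq h'
  rw [List.getLast?_append_of_ne_nil _ hT, ← this]
  simpa [eq_comm] using ht

theorem eq_of_D_eq {u u' : Word} (hu : IsWord u) (hu' : IsWord u') (hn : u ≠ []) (hn' : u' ≠ [])
    (hw : IsWord (D u)) (hD : D u = D u') (hh : u.head? = u'.head?)
    (hl : u.getLast? = u'.getLast?)
    (hf : D u ≠ [] → frontierLetter u = frontierLetter u')
    (hf' : D u ≠ [] → frontierLetter u.reverse = frontierLetter u'.reverse) : u = u' := by
  refine eq_of_rle_eq hu hu' ?_ hh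
  by_cases h : D u = []
  · rcases rle_eq_of_D_eq_nil hn h with h1 | h1 <;>
      rcases rle_eq_of_D_eq_nil hn' (hD ▸ h) with h2 | h2
    · rw [h1, h2]
    · exact absurd (hh ▸ hl ▸ head?_eq_getLast?_of_rle_eq h1) (head?_ne_getLast?_of_rle_eq h2)
    · exact absurd (hh ▸ hl ▸ head?_eq_getLast?_of_rle_eq h2) (head?_ne_getLast?_of_rle_eq h1)
    · rw [h1, h2]
  · have h' : D u' ≠ [] := hD ▸ h
    have hw' : IsWord (D u') := hD ▸ hw
    have first : (rle u).head? = some 1 ↔ (rle u').head? = some 1 := by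
      rw [head?_rle_eq_one_iff_frontierLetter hu h hw,
        head?_rle_eq_one_iff_frontierLetter hu' h' hw', hf h]
    have last : (rle u).reverse.head? = some 1 ↔ (rle u').reverse.head? = some 1 := by
      have key : ∀ {v : Word}, IsWord v → D v ≠ [] → IsWord (D v) →
          ((rle v).reverse.head? = some 1 ↔ frontierLetter v.reverse ≠ 2) := by
        intro v hv hvn hvD
        rw [← rle_reverse]
        refine head?_rle_eq_one_iff_frontierLetter (fun x hx => hv x (by simpa using hx)) ?_ ?_
        · simpa [D_reverse] using hvn
        · exact fun x hx => hvD x (by simpa [D_reverse] using hx)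
      rw [key hu h hw, key hu' h' hw', hf' h]
    rw [D_eq] at h h'
    rw [D_eq, D_eq, List.reverse_inj] at hD
    replace h := fun e => h (List.reverse_eq_nil_iff.2 e)
    replace h' := fun e => h' (List.reverse_eq_nil_iff.2 e)
    have hm : ∀ {r : List ℕ}, dropHeadOne (dropHeadOne r).reverse ≠ [] → dropHeadOne r ≠ [] := by
      intro r hr h0
      rw [h0] at hr
      exact hr rfl
    have := dropHeadOne_injective h hD (by
      rw [List.head?_reverse, List.head?_reverse, getLast?_dropHeadOne (hm h),
        getLast?_dropHeadOne (hm h'), ← List.head?_reverse, ← List.head?_reverse, last])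
    exact dropHeadOne_injective (hm h) (List.reverse_inj.1 this) first

theorem length_psi (w : Word) : (psi w).length = height w := by simp [psi]

theorem psi_eq_frontierLetter {w : Word} {i : ℕ} (hi : i + 1 < height w) :
    (psi w).getD (i + 1) 0 = frontierLetter (D^[i] w) := by
  simp [psi, frontierLetter, hi, ← Function.iterate_succ_apply']

theorem getD_iterate_D_eq {w : Word} {i : ℕ} (hi : i < height w) (hw : IsWord (D^[i] w)) :
    (D^[i] w).getD 0 0 = if (psi w).getD i 0 = 0 then 2 else (psi w).getD i 0 := by
  have h12 : (D^[i] w).getD 0 0 = 1 ∨ (D^[i] w).getD 0 0 = 2 := by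
    cases hd : D^[i] w with
    | nil => exact absurd hd (iterate_D_ne_nil hi)
    | cons a l => exact hw a (by simp [hd])
  rcases i with _ | i
  · have : (psi w).getD 0 0 = w.getD 0 0 := by simp [psi, hi]
    rw [this]
    simp only [Function.iterate_zero, id] at h12 ⊢
    split <;> omega
  · rw [psi_eq_frontierLetter hi, frontierLetter]
    rw [Function.iterate_succ_apply'] at h12 ⊢
    grind

theorem isWord_iterate_D {w : Word} (hw : w ∈ Cinf) (i : ℕ) : IsWord (D^[i] w) :=
  ((hw (i + 1)).2 i (Nat.lt_succ_self i)).1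

theorem head?_iterate_D_eq {w w' : Word} {i : ℕ} (hw : IsWord (D^[i] w))
    (hw' : IsWord (D^[i] w')) (hi : i < height w) (h : psi w = psi w') :
    (D^[i] w).head? = (D^[i] w').head? := by
  have hi' : i < height w' := by rwa [← length_psi, ← h, length_psi]
  have h1 := getD_iterate_D_eq hi hw
  rw [h, ← getD_iterate_D_eq hi' hw'] at h1
  have := iterate_D_ne_nil hi
  have := iterate_D_ne_nil hi'
  cases hd : D^[i] w <;> cases hd' : D^[i] w' <;> simp_all

end CinftyWords

open CinftyWords in
/-- Every C∞-word is uniquely determined by its vertical representation: if two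
C∞-words have the same left frontier and the same right frontier, they are equal. -/
theorem vertical_representation_injective (w w' : Word) (hw : w ∈ Cinf) (hw' : w' ∈ Cinf)
    (h1 : psi w = psi w') (h2 : psi w.reverse = psi w'.reverse) : w = w' := by
  have hh : height w' = height w := by rw [← length_psi, ← length_psi, h1]
  have hrw : ∀ {v : Word}, v ∈ Cinf → ∀ i, IsWord (D^[i] v.reverse) := by
    intro v hv i x hx
    exact isWord_iterate_D hv i x (by simpa [iterate_D_reverse] using hx)
  have key : ∀ i ≤ height w, D^[i] w = D^[i] w' := by
    intro i hi
    induction hi using Nat.decreasingInduction with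
    | self => rw [iterate_D_height, ← hh, iterate_D_height]
    | of_succ i hi ih =>
      have hi' : i < height w' := hh ▸ hi
      have hir : i < height w.reverse := by rwa [height_reverse]
      have next : D (D^[i] w) ≠ [] → i + 1 < height w := by
        intro hne
        refine lt_of_le_of_ne hi fun he => hne ?_
        rw [← Function.iterate_succ_apply' D, Nat.succ_eq_add_one, he, iterate_D_height]
      refine eq_of_D_eq (isWord_iterate_D hw i) (isWord_iterate_D hw' i) (iterate_D_ne_nil hi)
        (iterate_D_ne_nil hi') ?_ ?_
        (head?_iterate_D_eq (isWord_iterate_D hw i) (isWord_iterate_D hw' i) hi h1) ?_ ?_ ?_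
      · rw [← Function.iterate_succ_apply' D]
        exact isWord_iterate_D hw (i + 1)
      · rw [← Function.iterate_succ_apply' D, ← Function.iterate_succ_apply' D]
        exact ih
      · simpa [iterate_D_reverse] using head?_iterate_D_eq (hrw hw i) (hrw hw' i) hir h2
      · intro hne
        rw [← psi_eq_frontierLetter (next hne), ← psi_eq_frontierLetter (hh ▸ next hne), h1]
      · intro hne
        have hlt := next hne
        rw [← iterate_D_reverse, ← iterate_D_reverse, ← psi_eq_frontierLetter,
          ← psi_eq_frontierLetter, h2]
        · rwa [height_reverse, hh]
        · rwa [height_reverse]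
  exact key 0 (Nat.zero_le _)
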